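/- There exist constants c₁, c₂, C > 0 such that for every ε ∈ (0,1) there is a probability distribution Γ_ε over [0,1]×{0,1} with smCE(Γ_ε) ≥ c₁·ε^{5/2} and K_Gauss(Γ_ε) ≤ C·exp(−c₂/ε). -/

import Mathlib

open MeasureTheory Set

noncomputable section

/-- The unit interval `[0,1]` as a type. -/
abbrev I01 : Type := unitInterval

/-- The real value of a Boolean label. -/
def lbl (y : Bool) : ℝ := if y then 1 else 0

/-- The calibration correlation `E_{(v,y)∼Γ}[(y − v)·w(v)]` against a weight function `w`. -/
def calErr (Γ : Measure (I01 × Bool)) (w : I01 → ℝ) : ℝ :=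
  ∫ p, (lbl p.2 - (p.1 : ℝ)) * w p.1 ∂Γ

/-- A prediction-label distribution `Γ` on `[0,1] × {0,1}` is perfectly calibrated iff
`E[(y − v)·w(v)] = 0` for every bounded measurable weight function `w`. -/
def PerfCal (Γ : Measure (I01 × Bool)) : Prop :=
  ∀ w : I01 → ℝ, Measurable w → (∃ C : ℝ, ∀ t, |w t| ≤ C) → calErr Γ w = 0

/-- `ext(Γ)`: couplings `Π` of triples `(u,v,y)` whose `(v,y)`-marginal is `Γ` and whose
`(u,y)`-marginal is perfectly calibrated. -/
def extSet (Γ : Measure (I01 × Bool)) : Set (Measure (I01 × I01 × Bool)) :=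
  {π | IsProbabilityMeasure π ∧
    π.map (fun p => (p.2.1, p.2.2)) = Γ ∧
    PerfCal (π.map (fun p => (p.1, p.2.2)))}

/-- The lower distance to calibration `ldCE(Γ)`. -/
def ldCE (Γ : Measure (I01 × Bool)) : ℝ :=
  sInf {x | ∃ π ∈ extSet Γ, x = ∫ p, |(p.1 : ℝ) - (p.2.1 : ℝ)| ∂π}

/-- The upper distance to calibration `udCE(Γ)`: distance to calibration via post-processing. -/
def udCE (Γ : Measure (I01 × Bool)) : ℝ :=
  sInf {x | ∃ κ : I01 → I01, Measurable κ ∧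
    PerfCal (Γ.map (fun p => (κ p.1, p.2))) ∧
    x = ∫ p, |(p.1 : ℝ) - (κ p.1 : ℝ)| ∂Γ}

/-- The smooth calibration error `smCE(Γ)`: supremum of `E[(y−v)w(v)]` over `1`-Lipschitz
weight functions `w : [0,1] → [−1,1]`. -/
def smCE (Γ : Measure (I01 × Bool)) : ℝ :=
  sSup {x | ∃ w : I01 → ℝ, LipschitzWith 1 w ∧ (∀ t, |w t| ≤ 1) ∧ x = calErr Γ w}

/-- The prediction-label distribution `D_f` induced by a predictor `f`. -/
def predDist {𝒳 : Type*} [MeasurableSpace 𝒳] (D : Measure (𝒳 × Bool)) (f : 𝒳 → I01) :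
    Measure (I01 × Bool) :=
  D.map (fun p => (f p.1, p.2))

/-- `cal(D)`: the set of measurable predictors that are perfectly calibrated w.r.t. `D`. -/
def calSet {𝒳 : Type*} [MeasurableSpace 𝒳] (D : Measure (𝒳 × Bool)) : Set (𝒳 → I01) :=
  {g | Measurable g ∧ PerfCal (predDist D g)}

/-- The true (ℓ₁) distance to calibration `dCE_D(f)`. -/
def dCE {𝒳 : Type*} [MeasurableSpace 𝒳] (D : Measure (𝒳 × Bool)) (f : 𝒳 → I01) : ℝ :=
  sInf {x | ∃ g ∈ calSet D, x = ∫ p, |(f p.1 : ℝ) - (g p.1 : ℝ)| ∂D}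

/-- A finite partition of `[0,1]` into (order-convex) intervals. -/
structure IntervalPartition where
  m : ℕ
  piece : Fin m → Set ℝ
  ordConn : ∀ j, (piece j).OrdConnected
  disj : ∀ i j, i ≠ j → Disjoint (piece i) (piece j)
  cover : (⋃ j, piece j) = Set.Icc (0 : ℝ) 1

/-- `binnedECE(Γ, 𝓘) = Σ_j |E[(v − y)·1(v ∈ I_j)]|`. -/
def binnedECE (Γ : Measure (I01 × Bool)) (P : IntervalPartition) : ℝ :=
  ∑ j : Fin P.m,
    |∫ p, Set.indicator (P.piece j) (fun _ => ((p.1 : ℝ) - lbl p.2)) (p.1 : ℝ) ∂Γ|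

/-- The average interval width `w_Γ(𝓘) = Σ_j E[1(v ∈ I_j)]·w(I_j)`. -/
def avgWidth (Γ : Measure (I01 × Bool)) (P : IntervalPartition) : ℝ :=
  ∑ j : Fin P.m,
    (∫ p, Set.indicator (P.piece j) (fun _ => (1 : ℝ)) (p.1 : ℝ) ∂Γ) * Metric.diam (P.piece j)

/-- The interval calibration error `intCE(Γ)`. -/
def intCE (Γ : Measure (I01 × Bool)) : ℝ :=
  sInf {x | ∃ P : IntervalPartition, x = binnedECE Γ P + avgWidth Γ P}

/-- The random interval calibration error `RintCE(Γ, ε)`, with `r` uniform on `[0, ε)` and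
intervals `I^ε_{r,j} = [r + jε, r + (j+1)ε)`. -/
def RintCE (Γ : Measure (I01 × Bool)) (ε : ℝ) : ℝ :=
  (1 / ε) * ∫ r in Set.Ico (0 : ℝ) ε,
    ∑' j : ℤ, |∫ p, Set.indicator (Set.Ico (r + (j : ℝ) * ε) (r + ((j : ℝ) + 1) * ε))
      (fun _ => (lbl p.2 - (p.1 : ℝ))) (p.1 : ℝ) ∂Γ|

/-- The surrogate interval calibration error `SintCE(Γ)`. -/
def SintCE (Γ : Measure (I01 × Bool)) : ℝ :=
  ⨅ k : ℕ, (RintCE Γ ((1 / 2) ^ k) + (1 / 2) ^ k)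

/-- The squared Laplace-kernel calibration error:
`K_Lap(Γ) = E[(y−v)(y′−v′)·exp(−|v−v′|)]` over two independent samples from `Γ`. -/
def KLap (Γ : Measure (I01 × Bool)) : ℝ :=
  ∫ q, (lbl q.1.2 - (q.1.1 : ℝ)) * (lbl q.2.2 - (q.2.1 : ℝ)) *
    Real.exp (-|(q.1.1 : ℝ) - (q.2.1 : ℝ)|) ∂(Γ.prod Γ)

/-- The squared Gaussian-kernel calibration error:
`K_Gauss(Γ) = E[(y−v)(y′−v′)·exp(−(v−v′)²)]` over two independent samples from `Γ`. -/
def KGauss (Γ : Measure (I01 × Bool)) : ℝ :=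
  ∫ q, (lbl q.1.2 - (q.1.1 : ℝ)) * (lbl q.2.2 - (q.2.1 : ℝ)) *
    Real.exp (-(((q.1.1 : ℝ) - (q.2.1 : ℝ)) ^ 2)) ∂(Γ.prod Γ)

/-- Finitely supported prediction-label measure. -/
def finG (N : ℕ) (v : ℕ → I01) (m p : ℕ → ℝ) : Measure (I01 × Bool) :=
  ∑ j ∈ Finset.range N,
    (ENNReal.ofReal (m j * p j) • Measure.dirac (v j, true) +
      ENNReal.ofReal (m j * (1 - p j)) • Measure.dirac (v j, false))

lemma finG_integral (N : ℕ) (v : ℕ → I01) (m p : ℕ → ℝ) (hm : ∀ j, 0 ≤ m j)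
    (hp0 : ∀ j, 0 ≤ p j) (hp1 : ∀ j, p j ≤ 1) (f : I01 × Bool → ℝ) :
    ∫ q, f q ∂(finG N v m p) =
      ∑ j ∈ Finset.range N, (m j * p j * f (v j, true) + m j * (1 - p j) * f (v j, false)) := by
  have hd : ∀ (c : ℝ) (a : I01 × Bool), Integrable f (ENNReal.ofReal c • Measure.dirac a) :=
    fun c a => (integrable_dirac (by simp)).smul_measure (by simp)
  unfold finG
  rw [integral_finsetSum_measure]
  · refine Finset.sum_congr rfl fun j _ => ?_
    have h1 : 0 ≤ m j * p j := mul_nonneg (hm j) (hp0 j)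
    have h2 : 0 ≤ m j * (1 - p j) := mul_nonneg (hm j) (by linarith [hp1 j])
    rw [integral_add_measure (hd _ _) (hd _ _), integral_smul_measure, integral_smul_measure,
      integral_dirac, integral_dirac, ENNReal.toReal_ofReal h1, ENNReal.toReal_ofReal h2]
    simp
  · intro j _
    exact (hd _ _).add_measure (hd _ _)

lemma finG_prob (N : ℕ) (v : ℕ → I01) (m p : ℕ → ℝ) (hm : ∀ j, 0 ≤ m j)
    (hp0 : ∀ j, 0 ≤ p j) (hp1 : ∀ j, p j ≤ 1) (hs : ∑ j ∈ Finset.range N, m j = 1) :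
    IsProbabilityMeasure (finG N v m p) := by
  constructor
  unfold finG
  have : ∀ j, ENNReal.ofReal (m j * p j) + ENNReal.ofReal (m j * (1 - p j))
      = ENNReal.ofReal (m j) := by
    intro j
    have h1 : 0 ≤ m j * p j := mul_nonneg (hm j) (hp0 j)
    have h2 : 0 ≤ m j * (1 - p j) := mul_nonneg (hm j) (by linarith [hp1 j])
    rw [← ENNReal.ofReal_add h1 h2]
    congr 1
    ring
  simp only [Measure.coe_finsetSum, Finset.sum_apply, Measure.coe_add, Pi.add_apply,
    Measure.smul_apply, measure_univ, smul_eq_mul, mul_one, this]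
  rw [← ENNReal.ofReal_sum_of_nonneg (fun j _ => hm j), hs]
  simp

lemma finG_calErr (N : ℕ) (v : ℕ → I01) (m p : ℕ → ℝ) (hm : ∀ j, 0 ≤ m j)
    (hp0 : ∀ j, 0 ≤ p j) (hp1 : ∀ j, p j ≤ 1) (w : I01 → ℝ) :
    calErr (finG N v m p) w =
      ∑ j ∈ Finset.range N, m j * (p j - v j) * w (v j) := by
  unfold calErr
  rw [finG_integral N v m p hm hp0 hp1]
  refine Finset.sum_congr rfl fun j _ => ?_
  simp [lbl]
  ring

lemma abs_res_le (p : I01 × Bool) : |lbl p.2 - (p.1 : ℝ)| ≤ 1 := by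
  obtain ⟨⟨x, h0, h1⟩, y⟩ := p
  rw [abs_le]
  cases y <;> simp [lbl] <;> constructor <;> linarith

lemma meas_lbl : Measurable lbl := measurable_of_countable _

lemma smCE_ge (Γ : Measure (I01 × Bool)) [IsProbabilityMeasure Γ] (w : I01 → ℝ)
    (hw : LipschitzWith 1 w) (hb : ∀ t, |w t| ≤ 1) : calErr Γ w ≤ smCE Γ := by
  unfold smCE
  refine le_csSup ⟨1, ?_⟩ ⟨w, hw, hb, rfl⟩
  rintro x ⟨u, -, hu, rfl⟩
  unfold calErr
  have := norm_integral_le_of_norm_le_const (μ := Γ) (C := 1)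
    (f := fun p : I01 × Bool => (lbl p.2 - (p.1 : ℝ)) * u p.1)
    (Filter.Eventually.of_forall fun p => by
      rw [Real.norm_eq_abs, abs_mul]
      exact mul_le_one₀ (abs_res_le p) (abs_nonneg _) (hu _))
  simp only [Real.norm_eq_abs, probReal_univ, mul_one] at this
  exact (le_abs_self _).trans this

lemma finG_KGauss (N : ℕ) (v : ℕ → I01) (m p : ℕ → ℝ) (hm : ∀ j, 0 ≤ m j)
    (hp0 : ∀ j, 0 ≤ p j) (hp1 : ∀ j, p j ≤ 1) (hs : ∑ j ∈ Finset.range N, m j = 1) :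
    KGauss (finG N v m p) =
      ∑ i ∈ Finset.range N, ∑ j ∈ Finset.range N, (m i * (p i - v i)) * (m j * (p j - v j)) *
        Real.exp (-(((v i : ℝ) - v j) ^ 2)) := by
  haveI := finG_prob N v m p hm hp0 hp1 hs
  unfold KGauss
  have hl := meas_lbl
  rw [integral_prod]
  · have h1 : ∀ x : I01 × Bool, (∫ y, (lbl x.2 - (x.1 : ℝ)) * (lbl y.2 - (y.1 : ℝ)) *
        Real.exp (-(((x.1 : ℝ) - (y.1 : ℝ)) ^ 2)) ∂(finG N v m p)) =
        (lbl x.2 - (x.1 : ℝ)) * ∑ j ∈ Finset.range N, m j * (p j - v j) *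
          Real.exp (-(((x.1 : ℝ) - v j) ^ 2)) := by
      intro x
      simp only [mul_assoc]
      rw [integral_const_mul]
      congr 1
      have := finG_calErr N v m p hm hp0 hp1 (fun t => Real.exp (-(((x.1 : ℝ) - t) ^ 2)))
      unfold calErr at this
      rw [this]
      simp only [mul_assoc]
    simp only [h1]
    have := finG_calErr N v m p hm hp0 hp1 (fun t => ∑ j ∈ Finset.range N, m j * (p j - v j) *
          Real.exp (-(((t : ℝ) - v j) ^ 2)))
    unfold calErr at this
    rw [this]
    refine Finset.sum_congr rfl fun i _ => ?_
    rw [Finset.mul_sum]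
    refine Finset.sum_congr rfl fun j _ => ?_
    ring
  · refine Integrable.of_bound (Measurable.aestronglyMeasurable ?_) 1
      (Filter.Eventually.of_forall fun q => ?_)
    · fun_prop
    · rw [Real.norm_eq_abs, abs_mul, abs_mul, Real.abs_exp]
      refine mul_le_one₀ (mul_le_one₀ (abs_res_le _) (abs_nonneg _) (abs_res_le _))
        (Real.exp_pos _).le ?_
      rw [Real.exp_le_one_iff]
      nlinarith [sq_nonneg ((q.1.1 : ℝ) - q.2.1)]

lemma alt_sum_zero (n k : ℕ) (hk : k < n) :
    ∑ j ∈ Finset.range (n + 1), (-1 : ℝ) ^ j * (n.choose j) * ((n + j : ℝ) / (4 * n)) ^ k = 0 := by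
  have h := congrFun (fwdDiff_iter_pow_eq_zero_of_lt (R := ℝ) hk) (n : ℝ)
  rw [fwdDiff_iter_eq_sum_shift] at h
  simp only [Pi.zero_apply] at h
  have : ∑ j ∈ Finset.range (n + 1), (-1 : ℝ) ^ j * (n.choose j) * ((n + j : ℝ) / (4 * n)) ^ k
      = ((-1) ^ n / (4 * n) ^ k) * ∑ j ∈ Finset.range (n + 1),
        ((-1 : ℤ) ^ (n - j) * n.choose j) • ((n : ℝ) + j • (1 : ℝ)) ^ k := by
    rw [Finset.mul_sum]
    refine Finset.sum_congr rfl fun j hj => ?_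
    have hj' : j ≤ n := by simpa [Nat.lt_succ_iff] using hj
    obtain ⟨d, rfl⟩ := Nat.exists_eq_add_of_le hj'
    have e : (-1 : ℝ) ^ (j + d) * (-1) ^ d = (-1) ^ j := by
      rw [pow_add, mul_assoc, ← mul_pow]; simp
    rw [zsmul_eq_mul, div_pow, ← e]
    simp only [Nat.add_sub_cancel_left, nsmul_eq_mul, mul_one]
    push_cast
    ring
  rw [this, h, mul_zero]

lemma quad_bound (n : ℕ) (hn : 0 < n) (b x : ℕ → ℝ)
    (hb : ∑ j ∈ Finset.range (n + 1), |b j| = 1)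
    (hx : ∀ j, 0 ≤ x j ∧ x j ≤ 1 / 2)
    (hz : ∀ k < n, ∑ j ∈ Finset.range (n + 1), b j * x j ^ k = 0) :
    ∑ i ∈ Finset.range (n + 1), ∑ j ∈ Finset.range (n + 1),
      b i * b j * Real.exp (2 * x i * x j) ≤ 2 * (1 / 2) ^ n := by
  set T : ℝ → ℝ := fun t => ∑ k ∈ Finset.range n, t ^ k / k.factorial with hT
  have h0 : ∑ i ∈ Finset.range (n + 1), ∑ j ∈ Finset.range (n + 1),
      b i * b j * T (2 * x i * x j) = 0 := by
    have : ∀ i, ∑ j ∈ Finset.range (n + 1), b i * b j * T (2 * x i * x j) = 0 := by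
      intro i
      simp only [hT, Finset.mul_sum]
      rw [Finset.sum_comm]
      refine Finset.sum_eq_zero fun k hk => ?_
      have := hz k (by simpa using hk)
      calc _ = (b i * (2 * x i) ^ k / k.factorial) *
            ∑ j ∈ Finset.range (n + 1), b j * x j ^ k := by
            rw [Finset.mul_sum]
            refine Finset.sum_congr rfl fun j _ => ?_
            rw [mul_pow (2 * x i)]
            ring
        _ = 0 := by rw [this, mul_zero]
    exact Finset.sum_eq_zero fun i _ => this i
  have hR : ∀ i j, |Real.exp (2 * x i * x j) - T (2 * x i * x j)| ≤ 2 * (1 / 2) ^ n := by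
    intro i j
    obtain ⟨hi0, hi1⟩ := hx i
    obtain ⟨hj0, hj1⟩ := hx j
    have ht0 : 0 ≤ 2 * x i * x j := by positivity
    have ht1 : 2 * x i * x j ≤ 1 / 2 := by nlinarith
    have hb := Real.exp_bound (x := 2 * x i * x j) (by rw [abs_of_nonneg ht0]; linarith) hn
    refine hb.trans ?_
    rw [abs_of_nonneg ht0]
    have hn1 : (1 : ℝ) ≤ n := by exact_mod_cast hn
    have hf1 : (1 : ℝ) ≤ n.factorial := by exact_mod_cast n.factorial_pos
    have h2 : ((n.succ : ℝ) / (n.factorial * n)) ≤ 2 := by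
      rw [div_le_iff₀ (by positivity)]
      push_cast
      nlinarith
    calc _ ≤ (1 / 2 : ℝ) ^ n * 2 := by gcongr
      _ = _ := by ring
  calc _ = ∑ i ∈ Finset.range (n + 1), ∑ j ∈ Finset.range (n + 1),
        b i * b j * (Real.exp (2 * x i * x j) - T (2 * x i * x j)) := by
        simp only [mul_sub, Finset.sum_sub_distrib, h0, sub_zero]
    _ ≤ ∑ i ∈ Finset.range (n + 1), ∑ j ∈ Finset.range (n + 1),
        |b i| * |b j| * (2 * (1 / 2) ^ n) := by
        refine Finset.sum_le_sum fun i _ => Finset.sum_le_sum fun j _ => ?_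
        refine (le_abs_self _).trans ?_
        rw [abs_mul, abs_mul]
        exact mul_le_mul_of_nonneg_left (hR i j) (by positivity)
    _ = _ := by
        simp only [← Finset.sum_mul, ← Finset.mul_sum, hb]
        ring

lemma exists_dist (n : ℕ) (hn : 0 < n) : ∃ Γ : Measure (I01 × Bool), IsProbabilityMeasure Γ ∧
    1 / (128 * n : ℝ) ≤ smCE Γ ∧ KGauss Γ ≤ (1 / 2) ^ n := by
  have hn0 : (0 : ℝ) < n := by exact_mod_cast hn
  set x : ℕ → ℝ := fun j => ((n + min j n : ℕ) : ℝ) / (4 * n) with hxdef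
  have hx0 : ∀ j, 1 / 4 ≤ x j := by
    intro j
    simp only [hxdef]
    rw [div_le_div_iff₀ (by norm_num) (by positivity)]
    push_cast
    have : (0 : ℝ) ≤ min (j : ℝ) n := by positivity
    linarith
  have hx1 : ∀ j, x j ≤ 1 / 2 := by
    intro j
    simp only [hxdef]
    rw [div_le_div_iff₀ (by positivity) (by norm_num)]
    push_cast
    have : min (j : ℝ) n ≤ n := min_le_right _ _
    linarith
  have hxj : ∀ j ∈ Finset.range (n + 1), x j = (n + j : ℝ) / (4 * n) := by
    intro j hj
    have : j ≤ n := by simpa [Nat.lt_succ_iff] using hj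
    simp [hxdef, this]
  set v : ℕ → I01 := fun j => ⟨x j, by linarith [hx0 j], by linarith [hx1 j]⟩ with hv
  have hvx : ∀ j, (v j : ℝ) = x j := fun j => rfl
  set m : ℕ → ℝ := fun j => (n.choose j : ℝ) / 2 ^ n with hmdef
  have hm : ∀ j, 0 ≤ m j := fun j => by positivity
  have hs : ∑ j ∈ Finset.range (n + 1), m j = 1 := by
    simp only [hmdef, ← Finset.sum_div]
    rw [div_eq_one_iff_eq (by positivity)]
    exact_mod_cast Nat.sum_range_choose n
  set r : ℕ → ℝ := fun j => (-1) ^ j / 8 * Real.exp (x j ^ 2) with hr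
  have hE : ∀ j, Real.exp (x j ^ 2) ≤ 2 := by
    intro j
    have h1 : x j ^ 2 ≤ 1 / 2 := by nlinarith [hx0 j, hx1 j]
    have h2 := Real.exp_bound_div_one_sub_of_interval (sq_nonneg (x j)) (by linarith)
    refine h2.trans ?_
    rw [div_le_iff₀ (by linarith)]
    linarith
  have hrb : ∀ j, |r j| ≤ 1 / 4 := by
    intro j
    simp only [hr, abs_mul, abs_div, abs_pow, abs_neg, abs_one, one_pow, Real.abs_exp]
    norm_num
    linarith [hE j]
  set p : ℕ → ℝ := fun j => x j + r j with hp
  have hp0 : ∀ j, 0 ≤ p j := fun j => by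
    have := (abs_le.1 (hrb j)).1
    have := hx0 j
    simp only [hp]; linarith
  have hp1 : ∀ j, p j ≤ 1 := fun j => by
    have := (abs_le.1 (hrb j)).2
    have := hx1 j
    simp only [hp]; linarith
  have hpv : ∀ j, p j - v j = r j := fun j => by rw [hvx]; simp [hp]
  haveI hprob := finG_prob (n + 1) v m p hm hp0 hp1 hs
  refine ⟨finG (n + 1) v m p, hprob, ?_, ?_⟩
  · have hπ := Real.pi_pos
    set L : ℝ := 4 * n * Real.pi with hL
    have hn1 : (1 : ℝ) ≤ n := by exact_mod_cast hn
    have hL1 : 1 ≤ L := by nlinarith [Real.pi_gt_three]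
    have hL0 : 0 < L := by linarith
    set w : I01 → ℝ := fun t => Real.cos (L * (t : ℝ) - n * Real.pi) / L with hw
    have hwl : LipschitzWith 1 w := by
      refine LipschitzWith.of_dist_le_mul fun s t => ?_
      rw [Real.dist_eq, Subtype.dist_eq, Real.dist_eq]
      simp only [hw, ← sub_div, abs_div, abs_of_pos hL0]
      rw [div_le_iff₀ hL0]
      refine (Real.abs_cos_sub_cos_le _ _).trans (le_of_eq ?_)
      rw [show L * (s : ℝ) - n * Real.pi - (L * (t : ℝ) - n * Real.pi) = ((s : ℝ) - t) * L by ring,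
        abs_mul, abs_of_pos hL0]
      simp
    have hwb : ∀ t, |w t| ≤ 1 := by
      intro t
      simp only [hw, abs_div, abs_of_pos hL0]
      rw [div_le_one hL0]
      exact (Real.abs_cos_le_one _).trans hL1
    refine le_trans ?_ (smCE_ge _ w hwl hwb)
    rw [finG_calErr _ v m p hm hp0 hp1]
    calc 1 / (128 * n : ℝ) ≤ 1 / (8 * L) := by
          apply one_div_le_one_div_of_le (by positivity)
          nlinarith [Real.pi_le_four]
      _ = ∑ j ∈ Finset.range (n + 1), m j * (1 / (8 * L)) := by
          rw [← Finset.sum_mul, hs, one_mul]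
      _ ≤ _ := by
          refine Finset.sum_le_sum fun j hj => ?_
          rw [hpv, mul_assoc]
          refine mul_le_mul_of_nonneg_left ?_ (hm j)
          have hc : w (v j) = (-1) ^ j / L := by
            simp only [hw, hvx, hxj j hj]
            rw [show L * ((n + j : ℝ) / (4 * n)) - n * Real.pi = j * Real.pi by
              rw [hL]; field_simp; ring, Real.cos_nat_mul_pi]
          rw [hc]
          simp only [hr]
          have e : ((-1 : ℝ) ^ j) * (-1) ^ j = 1 := by rw [← mul_pow]; simp
          have e1 : (1 : ℝ) ≤ Real.exp (x j ^ 2) := Real.one_le_exp (sq_nonneg _)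
          calc 1 / (8 * L) ≤ Real.exp (x j ^ 2) * (1 / (8 * L)) :=
                le_mul_of_one_le_left (by positivity) e1
            _ = (((-1 : ℝ) ^ j) * (-1) ^ j) * (Real.exp (x j ^ 2) * (1 / (8 * L))) := by
                rw [e, one_mul]
            _ = _ := by field_simp
  · rw [finG_KGauss _ v m p hm hp0 hp1 hs]
    have hq := quad_bound n hn (fun j => (-1) ^ j * m j) x
      (by
        simp only [abs_mul, abs_pow, abs_neg, abs_one, one_pow, one_mul]
        simp only [abs_of_nonneg (hm _), hs])
      (fun j => ⟨by linarith [hx0 j], hx1 j⟩)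
      (by
        intro k hk
        have := alt_sum_zero n k hk
        calc _ = (1 / 2 ^ n) * ∑ j ∈ Finset.range (n + 1),
              (-1 : ℝ) ^ j * (n.choose j) * ((n + j : ℝ) / (4 * n)) ^ k := by
              rw [Finset.mul_sum]
              refine Finset.sum_congr rfl fun j hj => ?_
              rw [hxj j hj]
              simp only [hmdef]
              ring
          _ = 0 := by rw [this, mul_zero])
    calc _ = (1 / 64) * ∑ i ∈ Finset.range (n + 1), ∑ j ∈ Finset.range (n + 1),
          ((-1) ^ i * m i) * ((-1) ^ j * m j) * Real.exp (2 * x i * x j) := by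
          simp only [Finset.mul_sum]
          refine Finset.sum_congr rfl fun i _ => Finset.sum_congr rfl fun j _ => ?_
          rw [hpv, hpv, hvx, hvx]
          have : Real.exp (2 * x i * x j) =
              Real.exp (x i ^ 2) * Real.exp (x j ^ 2) * Real.exp (-((x i - x j) ^ 2)) := by
            rw [← Real.exp_add, ← Real.exp_add]
            congr 1
            ring
          rw [this]
          simp only [hr]
          ring
      _ ≤ (1 / 64) * (2 * (1 / 2) ^ n) := mul_le_mul_of_nonneg_left hq (by norm_num)
      _ ≤ _ := by
          have : (0 : ℝ) < (1 / 2) ^ n := by positivity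
          linarith

/-- Gaussian-kernel calibration error fails robust soundness: there are
constants `c₁, c₂, C > 0` so that for every `ε ∈ (0,1)` some distribution `Γ_ε` has
`smCE(Γ_ε) ≥ c₁·ε^{5/2}` while `K_Gauss(Γ_ε) ≤ C·exp(−c₂/ε)`. -/
theorem gaussian_kernel_not_sound :
    ∃ c₁ c₂ C : ℝ, 0 < c₁ ∧ 0 < c₂ ∧ 0 < C ∧
      ∀ ε : ℝ, 0 < ε → ε < 1 →
        ∃ Γ : Measure (I01 × Bool), IsProbabilityMeasure Γ ∧
          c₁ * ε ^ ((5 : ℝ) / 2) ≤ smCE Γ ∧ KGauss Γ ≤ C * Real.exp (-c₂ / ε) := by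
  refine ⟨1 / 256, Real.log 2, 1, by norm_num, Real.log_pos (by norm_num), one_pos, ?_⟩
  intro ε h0 h1
  have hinv : 1 < 1 / ε := by rw [lt_div_iff₀ h0]; linarith
  have hn : 0 < ⌈1 / ε⌉₊ := Nat.ceil_pos.2 (by linarith)
  obtain ⟨Γ, hP, hS, hK⟩ := exists_dist ⌈1 / ε⌉₊ hn
  have hle : 1 / ε ≤ (⌈1 / ε⌉₊ : ℝ) := Nat.le_ceil _
  have hlt : (⌈1 / ε⌉₊ : ℝ) < 1 / ε + 1 := Nat.ceil_lt_add_one (by linarith)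
  have hn0 : (0 : ℝ) < (⌈1 / ε⌉₊ : ℝ) := by linarith
  refine ⟨Γ, hP, le_trans ?_ hS, hK.trans ?_⟩
  · have hpow : ε ^ ((5 : ℝ) / 2) ≤ ε := by
      have := Real.rpow_le_rpow_of_exponent_ge h0 h1.le (show (1 : ℝ) ≤ 5 / 2 by norm_num)
      simpa using this
    have h2 : (⌈1 / ε⌉₊ : ℝ) * ε ≤ 2 := by
      have : (⌈1 / ε⌉₊ : ℝ) ≤ 2 * (1 / ε) := by linarith
      calc _ ≤ 2 * (1 / ε) * ε := by gcongr
        _ = 2 := by field_simp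
    calc 1 / 256 * ε ^ ((5 : ℝ) / 2) ≤ 1 / 256 * ε := by gcongr
      _ ≤ _ := by
        rw [le_div_iff₀ (by positivity)]
        nlinarith
  · rw [one_mul, ← Real.exp_log (show (0 : ℝ) < (1 / 2) ^ ⌈1 / ε⌉₊ by positivity),
      Real.exp_le_exp, Real.log_pow, one_div (2 : ℝ), Real.log_inv]
    have hl : 0 < Real.log 2 := Real.log_pos (by norm_num)
    have : -Real.log 2 / ε = -(1 / ε * Real.log 2) := by ring
    rw [this]
    nlinarith
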